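/- arXiv:1407.7930 — 5 statements merged into one kernel-verified Lean document; each statement's English description precedes it below -/
import Mathlib

section
/- Let G be a connected finite simple graph, let e = {x,y} be a bridge of G, and let x_1, …, x_k be vertices of G. Let A = {i : x_i ∈ Z_x} and B = {j : x_j ∈ Z_y} (so A and B partition {1,…,k}). Then Σ_{i=1}^k Σ_{j=1}^k d(x_i,x_j) = Σ_{i,j ∈ A} d(x_i,x_j) + Σ_{i,j ∈ B} d(x_i,x_j) + 2·( |B|·Σ_{i ∈ A} d(x_i,x) + |A|·Σ_{j ∈ B} d(y,x_j) + |A|·|B|·d(x,y) ). -/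
open Finset

namespace SimpleGraph

variable {V : Type*} {G : SimpleGraph V} {x y : V}

/-- An edge of `G` other than `s(x, y)` survives the deletion of `s(x, y)`. -/
theorem Adj.reachable_deleteEdges_of_ne {u w : V} (h : G.Adj u w) (hne : s(u, w) ≠ s(x, y)) :
    (G.deleteEdges {s(x, y)}).Reachable u w :=
  Adj.reachable (by simpa [deleteEdges_adj] using ⟨h, by simpa using hne⟩)

/-- A vertex joined to `x` in `G` is joined to `x` or to `y` after deleting `s(x, y)`. -/
theorem Walk.reachable_deleteEdges_left_or_right {v : V} (p : G.Walk v x) :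
    (G.deleteEdges {s(x, y)}).Reachable x v ∨ (G.deleteEdges {s(x, y)}).Reachable y v := by
  have key : ∀ {a b : V}, G.Walk a b → b = x →
      (G.deleteEdges {s(x, y)}).Reachable x a ∨ (G.deleteEdges {s(x, y)}).Reachable y a := by
    intro a b q
    induction q with
    | nil => rintro rfl; exact Or.inl .rfl
    | @cons a w b h q ih =>
      intro hb
      by_cases he : s(a, w) = s(x, y)
      · rcases Sym2.eq_iff.mp he with ⟨rfl, rfl⟩ | ⟨rfl, rfl⟩
        · exact Or.inl .rfl
        · exact Or.inr .rfl
      · have haw := (h.reachable_deleteEdges_of_ne he).symm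
        exact (ih hb).imp (·.trans haw) (·.trans haw)
  exact key p rfl

/-- A walk crossing a bridge `s(x, y)` is at least as long as the detour through `x` and `y`. -/
theorem Walk.dist_add_one_add_dist_le_length (hG : G.Connected)
    (hbridge : ¬ (G.deleteEdges {s(x, y)}).Reachable x y) {u v : V} (p : G.Walk u v)
    (hu : (G.deleteEdges {s(x, y)}).Reachable x u)
    (hv : ¬ (G.deleteEdges {s(x, y)}).Reachable x v) :
    G.dist u x + 1 + G.dist y v ≤ p.length := by
  induction p with
  | nil => exact absurd hu hv
  | @cons u w v h p ih =>
    rw [Walk.length_cons]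
    by_cases he : s(u, w) = s(x, y)
    · rcases Sym2.eq_iff.mp he with ⟨rfl, rfl⟩ | ⟨rfl, rfl⟩
      · have := G.dist_le p
        rw [dist_self]
        lia
      · exact absurd hu hbridge
    · have hw := ih (hu.trans (h.reachable_deleteEdges_of_ne he)) hv
      have htri : G.dist u x ≤ G.dist u w + G.dist w x := hG.dist_triangle
      rw [dist_eq_one_iff_adj.mpr h] at htri
      lia

/-- Distances between the two sides of a bridge are additive along the bridge. -/
theorem Connected.dist_eq_of_bridge (hG : G.Connected) (hxy : G.Adj x y)
    (hbridge : ¬ (G.deleteEdges {s(x, y)}).Reachable x y) {u v : V}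
    (hu : (G.deleteEdges {s(x, y)}).Reachable x u)
    (hv : (G.deleteEdges {s(x, y)}).Reachable y v) :
    G.dist u v = G.dist u x + G.dist y v + G.dist x y := by
  obtain ⟨p, hp⟩ := hG.exists_walk_length_eq_dist u v
  have hle := p.dist_add_one_add_dist_le_length hG hbridge hu fun h ↦ hbridge (h.trans hv.symm)
  have h₁ : G.dist u v ≤ G.dist u x + G.dist x v := hG.dist_triangle
  have h₂ : G.dist x v ≤ G.dist x y + G.dist y v := hG.dist_triangle
  rw [dist_eq_one_iff_adj.mpr hxy] at h₂ ⊢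
  lia

end SimpleGraph

/-- Decomposition of the all-pairs distance cost across a bridge `e = {x,y}`:
with `A` the indices of selected vertices lying in `Z_x` and `B` those lying
in `Z_y`, we have
`Σ_{i,j} d(x_i,x_j) = Σ_{i,j∈A} d(x_i,x_j) + Σ_{i,j∈B} d(x_i,x_j)
  + 2(|B|·Σ_{i∈A} d(x_i,x) + |A|·Σ_{j∈B} d(y,x_j) + |A||B|·d(x,y))`. -/
theorem allPairs_dist_decomposition_across_bridge {V : Type*} [Fintype V]
    (G : SimpleGraph V) (hG : G.Connected) (x y : V) (hxy : G.Adj x y)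
    (hbridge : ¬ (G.deleteEdges {s(x, y)}).Reachable x y)
    (k : ℕ) (f : Fin k → V) (A B : Finset (Fin k))
    (hA : ∀ i, i ∈ A ↔ (G.deleteEdges {s(x, y)}).Reachable x (f i))
    (hB : ∀ i, i ∈ B ↔ (G.deleteEdges {s(x, y)}).Reachable y (f i)) :
    ∑ i : Fin k, ∑ j : Fin k, G.dist (f i) (f j) =
      (∑ i ∈ A, ∑ j ∈ A, G.dist (f i) (f j)) +
      (∑ i ∈ B, ∑ j ∈ B, G.dist (f i) (f j)) +
      2 * (B.card * ∑ i ∈ A, G.dist (f i) x +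
           A.card * ∑ j ∈ B, G.dist y (f j) +
           A.card * B.card * G.dist x y) := by
  have hdisj : Disjoint A B := Finset.disjoint_left.mpr fun i hiA hiB ↦
    hbridge (((hA i).mp hiA).trans ((hB i).mp hiB).symm)
  have hunion : A.disjUnion B hdisj = univ := by
    ext i
    obtain ⟨p⟩ := hG.preconnected (f i) x
    simpa [hA, hB] using p.reachable_deleteEdges_left_or_right
  have hcross : ∑ i ∈ A, ∑ j ∈ B, G.dist (f i) (f j) =
      B.card * ∑ i ∈ A, G.dist (f i) x + A.card * ∑ j ∈ B, G.dist y (f j) +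
        A.card * B.card * G.dist x y := by
    rw [Finset.sum_congr rfl fun i hi ↦ Finset.sum_congr rfl fun j hj ↦
      hG.dist_eq_of_bridge hxy hbridge ((hA i).mp hi) ((hB j).mp hj)]
    simp [Finset.sum_add_distrib, Finset.mul_sum, mul_assoc]
  have hcross' : ∑ i ∈ B, ∑ j ∈ A, G.dist (f i) (f j) =
      ∑ i ∈ A, ∑ j ∈ B, G.dist (f i) (f j) := by
    rw [Finset.sum_comm]
    simp only [G.dist_comm]
  rw [← hunion]
  simp only [Finset.sum_disjUnion, Finset.sum_add_distrib]
  rw [hcross', hcross]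
  ring
end

section
/- Consider an ExtMinDR instance (G, {X_1,…,X_k}, b) and a bridge e = {t_0,t_1} of G such that each G[X_i] is connected and t_0, t_1 do not both belong to the same X_i; assume every X_i is contained in Z_0 or in Z_1, and let Y_s = {i : X_i ⊆ Z_s}. For a feasible solution S given by x_1,…,x_k with x_i ∈ X_i, and for s ∈ {0,1}, define f_s(S) = Σ_{i,j ∈ Y_s} d(x_i,x_j) + Σ_{i ∈ Y_s} Σ_{z ∈ Z_s} b(z)·d(x_i,z) + ( 2|Y_{1−s}| + Σ_{z ∈ Z_{1−s}} b(z) ) · Σ_{i ∈ Y_s} d(x_i,t_s). Then the cost of S satisfies f(S) = f_0(S) + f_1(S) + 2|Y_0||Y_1|·d(t_0,t_1) + Σ_{s ∈ {0,1}} ( |Y_s| · Σ_{z ∈ Z_{1−s}} b(z)·d(t_s,z) ). -/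
open Finset

namespace SimpleGraph

variable {V : Type*} {G : SimpleGraph V} {s t : V}

/-- A walk crossing a bridge `s(s, t)` is at least as long as the detour through `s` and `t`. -/
lemma Walk.dist_add_one_add_dist_le_length_of_not_reachable (hG : G.Connected)
    (hst : ¬ (G.deleteEdges {s(s, t)}).Reachable s t) {u v : V} (p : G.Walk u v)
    (hu : (G.deleteEdges {s(s, t)}).Reachable s u)
    (hv : (G.deleteEdges {s(s, t)}).Reachable t v) :
    G.dist u s + 1 + G.dist t v ≤ p.length := by
  induction p with
  | nil => exact absurd (hu.trans hv.symm) hst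
  | @cons u w v h p ih =>
    rw [Walk.length_cons]
    by_cases he : s(u, w) = s(s, t)
    · rcases Sym2.eq_iff.mp he with ⟨rfl, rfl⟩ | ⟨rfl, rfl⟩
      · have := dist_le p
        rw [dist_self]
        omega
      · exact absurd hu hst
    · have hadj : (G.deleteEdges {s(s, t)}).Adj u w := by
        rw [deleteEdges_adj]
        exact ⟨h, he⟩
      have := ih (hu.trans hadj.reachable) hv
      have := hG.dist_triangle (u := u) (v := w) (w := s)
      rw [dist_eq_one_iff_adj.mpr h] at this
      omega

lemma Connected.dist_eq_of_not_reachable_deleteEdges (hG : G.Connected) (h : G.Adj s t)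
    (hst : ¬ (G.deleteEdges {s(s, t)}).Reachable s t) {u v : V}
    (hu : (G.deleteEdges {s(s, t)}).Reachable s u)
    (hv : (G.deleteEdges {s(s, t)}).Reachable t v) :
    G.dist u v = G.dist u s + G.dist s t + G.dist t v := by
  obtain ⟨p, hp⟩ := hG.exists_walk_length_eq_dist u v
  have := p.dist_add_one_add_dist_le_length_of_not_reachable hG hst hu hv
  have := hG.dist_triangle (u := u) (v := s) (w := v)
  have := hG.dist_triangle (u := s) (v := t) (w := v)
  have := dist_eq_one_iff_adj.mpr h
  omega

lemma Walk.reachable_deleteEdges_or {u v : V} (p : G.Walk u v)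
    (hu : (G.deleteEdges {s(s, t)}).Reachable s u ∨ (G.deleteEdges {s(s, t)}).Reachable t u) :
    (G.deleteEdges {s(s, t)}).Reachable s v ∨ (G.deleteEdges {s(s, t)}).Reachable t v := by
  induction p with
  | nil => exact hu
  | @cons u w v h p ih =>
    refine ih ?_
    by_cases he : s(u, w) = s(s, t)
    · rcases Sym2.eq_iff.mp he with ⟨rfl, rfl⟩ | ⟨rfl, rfl⟩
      · exact .inr .rfl
      · exact .inl .rfl
    · have hadj : (G.deleteEdges {s(s, t)}).Adj u w := by
        rw [deleteEdges_adj]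
        exact ⟨h, he⟩
      exact hu.imp (·.trans hadj.reachable) (·.trans hadj.reachable)

end SimpleGraph

/-- Decomposition of the ExtMinDR cost of a feasible solution across a bridge
`e = {t₀,t₁}` (Theorem 2 of the paper, cost identity for a fixed solution). -/
theorem extMinDR_cost_decomposition {V : Type*} [Fintype V]
    (G : SimpleGraph V) (hG : G.Connected)
    (k : ℕ) (X : Fin k → Set V)
    (hXne : ∀ i, (X i).Nonempty)
    (hXdisj : ∀ i j, i ≠ j → Disjoint (X i) (X j))
    (b : V → ℝ) (hb : ∀ v, 0 ≤ b v)
    (t₀ t₁ : V) (ht : G.Adj t₀ t₁)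
    (hbridge : ¬ (G.deleteEdges {s(t₀, t₁)}).Reachable t₀ t₁)
    (Z₀ Z₁ : Finset V)
    (hZ₀ : ∀ v, v ∈ Z₀ ↔ (G.deleteEdges {s(t₀, t₁)}).Reachable t₀ v)
    (hZ₁ : ∀ v, v ∈ Z₁ ↔ (G.deleteEdges {s(t₀, t₁)}).Reachable t₁ v)
    (hXconn : ∀ i, (G.induce (X i)).Connected)
    (hXsep : ∀ i, ¬ (t₀ ∈ X i ∧ t₁ ∈ X i))
    (hXside : ∀ i, X i ⊆ ↑Z₀ ∨ X i ⊆ ↑Z₁)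
    (Y₀ Y₁ : Finset (Fin k))
    (hY₀ : ∀ i, i ∈ Y₀ ↔ X i ⊆ ↑Z₀)
    (hY₁ : ∀ i, i ∈ Y₁ ↔ X i ⊆ ↑Z₁)
    (x : Fin k → V) (hx : ∀ i, x i ∈ X i) :
    (∑ i : Fin k, ∑ j : Fin k, (G.dist (x i) (x j) : ℝ)) +
      (∑ i : Fin k, ∑ z : V, b z * (G.dist (x i) z : ℝ)) =
    ((∑ i ∈ Y₀, ∑ j ∈ Y₀, (G.dist (x i) (x j) : ℝ)) +
        (∑ i ∈ Y₀, ∑ z ∈ Z₀, b z * (G.dist (x i) z : ℝ)) +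
        (2 * (Y₁.card : ℝ) + ∑ z ∈ Z₁, b z) * ∑ i ∈ Y₀, (G.dist (x i) t₀ : ℝ)) +
    ((∑ i ∈ Y₁, ∑ j ∈ Y₁, (G.dist (x i) (x j) : ℝ)) +
        (∑ i ∈ Y₁, ∑ z ∈ Z₁, b z * (G.dist (x i) z : ℝ)) +
        (2 * (Y₀.card : ℝ) + ∑ z ∈ Z₀, b z) * ∑ i ∈ Y₁, (G.dist (x i) t₁ : ℝ)) +
    2 * (Y₀.card : ℝ) * (Y₁.card : ℝ) * (G.dist t₀ t₁ : ℝ) +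
    ((Y₀.card : ℝ) * ∑ z ∈ Z₁, b z * (G.dist t₀ z : ℝ) +
     (Y₁.card : ℝ) * ∑ z ∈ Z₀, b z * (G.dist t₁ z : ℝ)) := by
  classical
  have hd : ∀ u ∈ Z₀, ∀ v ∈ Z₁,
      (G.dist u v : ℝ) = G.dist u t₀ + G.dist t₀ t₁ + G.dist t₁ v := fun u hu v hv ↦ by
    exact_mod_cast hG.dist_eq_of_not_reachable_deleteEdges ht hbridge
      ((hZ₀ u).mp hu) ((hZ₁ v).mp hv)
  have hZdisj : Disjoint Z₀ Z₁ := Finset.disjoint_left.mpr fun v h₀ h₁ ↦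
    hbridge (((hZ₀ v).mp h₀).trans ((hZ₁ v).mp h₁).symm)
  have hZunion : Z₀ ∪ Z₁ = univ := Finset.eq_univ_of_forall fun v ↦ by
    obtain ⟨p⟩ := hG.preconnected t₀ v
    rw [Finset.mem_union, hZ₀, hZ₁]
    exact p.reachable_deleteEdges_or (.inl .rfl)
  have hx₀ : ∀ i ∈ Y₀, x i ∈ Z₀ := fun i hi ↦ (hY₀ i).mp hi (hx i)
  have hx₁ : ∀ i ∈ Y₁, x i ∈ Z₁ := fun i hi ↦ (hY₁ i).mp hi (hx i)
  have hYdisj : Disjoint Y₀ Y₁ := Finset.disjoint_left.mpr fun i h₀ h₁ ↦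
    Finset.disjoint_left.mp hZdisj (hx₀ i h₀) (hx₁ i h₁)
  have hYunion : Y₀ ∪ Y₁ = univ := Finset.eq_univ_of_forall fun i ↦ by
    rw [Finset.mem_union, hY₀, hY₁]
    exact hXside i
  have hsumZ (f : V → ℝ) : ∑ z, f z = ∑ z ∈ Z₀, f z + ∑ z ∈ Z₁, f z := by
    rw [← hZunion, Finset.sum_union hZdisj]
  have hsumY (f : Fin k → ℝ) : ∑ i, f i = ∑ i ∈ Y₀, f i + ∑ i ∈ Y₁, f i := by
    rw [← hYunion, Finset.sum_union hYdisj]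
  have hYY : ∑ i ∈ Y₀, ∑ j ∈ Y₁, (G.dist (x i) (x j) : ℝ) =
      (Y₁.card : ℝ) * ∑ i ∈ Y₀, (G.dist (x i) t₀ : ℝ) +
        (Y₀.card : ℝ) * (Y₁.card : ℝ) * (G.dist t₀ t₁ : ℝ) +
        (Y₀.card : ℝ) * ∑ j ∈ Y₁, (G.dist (x j) t₁ : ℝ) := by
    rw [Finset.sum_congr rfl fun i hi ↦ Finset.sum_congr rfl fun j hj ↦
      hd _ (hx₀ i hi) _ (hx₁ j hj)]
    simp only [Finset.sum_add_distrib, Finset.sum_const, nsmul_eq_mul, Finset.mul_sum,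
      G.dist_comm (u := t₁)]
    ring
  have hYY' : ∑ i ∈ Y₁, ∑ j ∈ Y₀, (G.dist (x i) (x j) : ℝ) =
      ∑ i ∈ Y₀, ∑ j ∈ Y₁, (G.dist (x i) (x j) : ℝ) := by
    rw [Finset.sum_comm]
    simp only [G.dist_comm]
  have hYZ : ∑ i ∈ Y₀, ∑ z ∈ Z₁, b z * (G.dist (x i) z : ℝ) =
      (∑ z ∈ Z₁, b z) * ∑ i ∈ Y₀, (G.dist (x i) t₀ : ℝ) +
        (Y₀.card : ℝ) * ∑ z ∈ Z₁, b z * (G.dist t₀ z : ℝ) := by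
    have h (i) (hi : i ∈ Y₀) (z) (hz : z ∈ Z₁) : b z * (G.dist (x i) z : ℝ) =
        b z * G.dist (x i) t₀ + b z * G.dist t₀ z := by
      rw [hd _ (hx₀ i hi) z hz, hd t₀ ((hZ₀ t₀).mpr .rfl) z hz, SimpleGraph.dist_self]
      push_cast
      ring
    rw [Finset.sum_congr rfl fun i hi ↦ Finset.sum_congr rfl (h i hi)]
    simp only [Finset.sum_add_distrib, Finset.sum_const, nsmul_eq_mul, ← Finset.sum_mul,
      ← Finset.mul_sum]
  have hZY : ∑ i ∈ Y₁, ∑ z ∈ Z₀, b z * (G.dist (x i) z : ℝ) =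
      (∑ z ∈ Z₀, b z) * ∑ i ∈ Y₁, (G.dist (x i) t₁ : ℝ) +
        (Y₁.card : ℝ) * ∑ z ∈ Z₀, b z * (G.dist t₁ z : ℝ) := by
    have h (i) (hi : i ∈ Y₁) (z) (hz : z ∈ Z₀) : b z * (G.dist (x i) z : ℝ) =
        b z * G.dist (x i) t₁ + b z * G.dist t₁ z := by
      rw [G.dist_comm (u := x i) (v := z), G.dist_comm (u := t₁) (v := z),
        G.dist_comm (u := x i) (v := t₁), hd z hz _ (hx₁ i hi),
        hd z hz t₁ ((hZ₁ t₁).mpr .rfl), SimpleGraph.dist_self]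
      push_cast
      ring
    rw [Finset.sum_congr rfl fun i hi ↦ Finset.sum_congr rfl (h i hi)]
    simp only [Finset.sum_add_distrib, Finset.sum_const, nsmul_eq_mul, ← Finset.sum_mul,
      ← Finset.mul_sum]
  simp only [hsumZ, hsumY, Finset.sum_add_distrib]
  rw [hYY', hYY, hYZ, hZY]
  ring
end

section
/- Consider an ExtMinDR instance (G, {X_1,…,X_k}, b) and a bridge e = {t_0,t_1} of G such that each G[X_i] is connected and t_0, t_1 do not both belong to the same X_i; assume every X_i is contained in Z_0 or in Z_1, and let Y_s = {i : X_i ⊆ Z_s}, with both Y_0 and Y_1 nonempty. For s ∈ {0,1} and a choice (x_i)_{i ∈ Y_s} with x_i ∈ X_i, define f_s((x_i)_{i∈Y_s}) = Σ_{i,j ∈ Y_s} d(x_i,x_j) + Σ_{i ∈ Y_s} Σ_{z ∈ Z_s} b(z)·d(x_i,z) + ( 2|Y_{1−s}| + Σ_{z ∈ Z_{1−s}} b(z) ) · Σ_{i ∈ Y_s} d(x_i,t_s). Then the minimum cost over all feasible solutions of the instance equals ( min over choices (x_i)_{i ∈ Y_0} of f_0 ) + ( min over choices (x_i)_{i ∈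 Y_1} of f_1 ) + 2|Y_0||Y_1|·d(t_0,t_1) + Σ_{s ∈ {0,1}} ( |Y_s| · Σ_{z ∈ Z_{1−s}} b(z)·d(t_s,z) ). -/
open Finset

/-- If the endpoints of a walk are separated by deleting the edge `e`, then the distance between
them splits at every endpoint `w` of `e`. -/
lemma SimpleGraph.Connected.dist_eq_add_of_not_reachable_deleteEdges {V : Type*}
    {G : SimpleGraph V} (hG : G.Connected) {e : Sym2 V} {u v w : V} (hw : w ∈ e)
    (h : ¬ (G.deleteEdges {e}).Reachable u v) :
    G.dist u v = G.dist u w + G.dist w v := by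
  classical
  refine le_antisymm hG.dist_triangle ?_
  obtain ⟨p, hp⟩ := hG.exists_walk_length_eq_dist u v
  have he : e ∈ p.edges := by
    by_contra hne
    exact h ⟨p.toDeleteEdges {e} fun a ha hae => hne (by
      rw [Set.mem_singleton_iff] at hae; exact hae ▸ ha)⟩
  have hws : w ∈ p.support := by
    obtain ⟨x, rfl⟩ := Sym2.mem_iff_exists.1 hw
    exact p.fst_mem_support_of_mem_edges he
  have hlen := congrArg SimpleGraph.Walk.length (p.take_spec hws)
  rw [SimpleGraph.Walk.length_append] at hlen
  have h₁ := SimpleGraph.dist_le (p.takeUntil w hws)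
  have h₂ := SimpleGraph.dist_le (p.dropUntil w hws)
  omega

/-- After deleting an edge of a connected graph, every vertex is reachable from one of its ends. -/
lemma SimpleGraph.Connected.reachable_deleteEdges_or {V : Type*} {G : SimpleGraph V}
    (hG : G.Connected) (t₀ t₁ v : V) :
    (G.deleteEdges {s(t₀, t₁)}).Reachable t₀ v ∨ (G.deleteEdges {s(t₀, t₁)}).Reachable t₁ v := by
  have h := (SimpleGraph.reachable_iff_reflTransGen t₀ v).1 (hG t₀ v)
  induction h with
  | refl => exact Or.inl .rfl
  | @tail a c _ hac ih =>
    by_cases he : s(a, c) = s(t₀, t₁)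
    · rcases Sym2.eq_iff.1 he with ⟨_, rfl⟩ | ⟨_, rfl⟩
      · exact Or.inr .rfl
      · exact Or.inl .rfl
    · have hadj : (G.deleteEdges {s(t₀, t₁)}).Adj a c := by
        rw [SimpleGraph.deleteEdges_adj]
        exact ⟨hac, he⟩
      exact ih.imp (·.trans hadj.reachable) (·.trans hadj.reachable)

/-- The minimum of a sum of two functions that can be optimised independently of each other. -/
lemma ciInf_add_add_const_of_independent {α : Type*} [Finite α] [Nonempty α] (f g : α → ℝ) (c : ℝ)
    (h : ∀ s t, ∃ r, f r = f s ∧ g r = g t) :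
    ⨅ a, (f a + g a + c) = (⨅ a, f a) + (⨅ a, g a) + c := by
  have bdd (q : α → ℝ) : BddBelow (Set.range q) := (Set.finite_range q).bddBelow
  apply le_antisymm
  · obtain ⟨s, hs⟩ := exists_eq_ciInf_of_finite (f := f)
    obtain ⟨t, ht⟩ := exists_eq_ciInf_of_finite (f := g)
    obtain ⟨r, hr, hr'⟩ := h s t
    rw [← hs, ← ht, ← hr, ← hr']
    exact ciInf_le (bdd fun a => f a + g a + c) r
  · refine le_ciInf fun a => ?_
    linarith [ciInf_le (bdd f) a, ciInf_le (bdd g) a]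

/-- Decomposition of the optimal ExtMinDR cost across a bridge `e = {t₀,t₁}`
(Theorem 2 of the paper): the minimum cost over feasible solutions equals the
sum of the minima of the two subproblem costs plus explicit correction terms. -/
theorem extMinDR_optimal_decomposition {V : Type*} [Fintype V]
    (G : SimpleGraph V) (hG : G.Connected)
    (k : ℕ) (X : Fin k → Set V)
    (hXne : ∀ i, (X i).Nonempty)
    (hXdisj : ∀ i j, i ≠ j → Disjoint (X i) (X j))
    (b : V → ℝ) (hb : ∀ v, 0 ≤ b v)
    (t₀ t₁ : V) (ht : G.Adj t₀ t₁)
    (hbridge : ¬ (G.deleteEdges {s(t₀, t₁)}).Reachable t₀ t₁)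
    (Z₀ Z₁ : Finset V)
    (hZ₀ : ∀ v, v ∈ Z₀ ↔ (G.deleteEdges {s(t₀, t₁)}).Reachable t₀ v)
    (hZ₁ : ∀ v, v ∈ Z₁ ↔ (G.deleteEdges {s(t₀, t₁)}).Reachable t₁ v)
    (hXconn : ∀ i, (G.induce (X i)).Connected)
    (hXsep : ∀ i, ¬ (t₀ ∈ X i ∧ t₁ ∈ X i))
    (hXside : ∀ i, X i ⊆ ↑Z₀ ∨ X i ⊆ ↑Z₁)
    (Y₀ Y₁ : Finset (Fin k))
    (hY₀ : ∀ i, i ∈ Y₀ ↔ X i ⊆ ↑Z₀)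
    (hY₁ : ∀ i, i ∈ Y₁ ↔ X i ⊆ ↑Z₁)
    (hY₀ne : Y₀.Nonempty) (hY₁ne : Y₁.Nonempty) :
    (⨅ S : {x : Fin k → V // ∀ i, x i ∈ X i},
        (∑ i : Fin k, ∑ j : Fin k, (G.dist (S.1 i) (S.1 j) : ℝ)) +
          (∑ i : Fin k, ∑ z : V, b z * (G.dist (S.1 i) z : ℝ))) =
    (⨅ S : {x : Fin k → V // ∀ i, x i ∈ X i},
        (∑ i ∈ Y₀, ∑ j ∈ Y₀, (G.dist (S.1 i) (S.1 j) : ℝ)) +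
          (∑ i ∈ Y₀, ∑ z ∈ Z₀, b z * (G.dist (S.1 i) z : ℝ)) +
          (2 * (Y₁.card : ℝ) + ∑ z ∈ Z₁, b z) * ∑ i ∈ Y₀, (G.dist (S.1 i) t₀ : ℝ)) +
    (⨅ S : {x : Fin k → V // ∀ i, x i ∈ X i},
        (∑ i ∈ Y₁, ∑ j ∈ Y₁, (G.dist (S.1 i) (S.1 j) : ℝ)) +
          (∑ i ∈ Y₁, ∑ z ∈ Z₁, b z * (G.dist (S.1 i) z : ℝ)) +
          (2 * (Y₀.card : ℝ) + ∑ z ∈ Z₀, b z) * ∑ i ∈ Y₁, (G.dist (S.1 i) t₁ : ℝ)) +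
    2 * (Y₀.card : ℝ) * (Y₁.card : ℝ) * (G.dist t₀ t₁ : ℝ) +
    ((Y₀.card : ℝ) * ∑ z ∈ Z₁, b z * (G.dist t₀ z : ℝ) +
     (Y₁.card : ℝ) * ∑ z ∈ Z₀, b z * (G.dist t₁ z : ℝ)) := by
  classical
  have hdist (w u v) (hw : w ∈ s(t₀, t₁)) (hu : u ∈ Z₀) (hv : v ∈ Z₁) :
      G.dist u v = G.dist u w + G.dist w v := by
    refine hG.dist_eq_add_of_not_reachable_deleteEdges hw fun h => hbridge ?_
    exact ((hZ₀ u).1 hu).trans (h.trans ((hZ₁ v).1 hv).symm)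
  have ht₀ : t₀ ∈ Z₀ := (hZ₀ _).2 .rfl
  have ht₁ : t₁ ∈ Z₁ := (hZ₁ _).2 .rfl
  have hZdisj : Disjoint Z₀ Z₁ := by
    refine Finset.disjoint_left.2 fun v h₀ h₁ => hbridge ?_
    exact ((hZ₀ v).1 h₀).trans ((hZ₁ v).1 h₁).symm
  have hZcover : Z₀ ∪ Z₁ = univ := by
    ext v
    simpa [hZ₀, hZ₁] using hG.reachable_deleteEdges_or t₀ t₁ v
  have hYdisj : Disjoint Y₀ Y₁ := by
    refine Finset.disjoint_left.2 fun i h₀ h₁ => ?_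
    obtain ⟨v, hv⟩ := hXne i
    exact Finset.disjoint_left.1 hZdisj ((hY₀ i).1 h₀ hv) ((hY₁ i).1 h₁ hv)
  have hYcover : Y₀ ∪ Y₁ = univ := by
    ext i
    simpa [hY₀, hY₁] using hXside i
  have sumY (q : Fin k → ℝ) : ∑ i, q i = ∑ i ∈ Y₀, q i + ∑ i ∈ Y₁, q i := by
    rw [← hYcover, Finset.sum_union hYdisj]
  have sumZ (q : V → ℝ) : ∑ z, q z = ∑ z ∈ Z₀, q z + ∑ z ∈ Z₁, q z := by
    rw [← hZcover, Finset.sum_union hZdisj]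
  have : Nonempty {x : Fin k → V // ∀ i, x i ∈ X i} :=
    ⟨⟨fun i => (hXne i).some, fun i => (hXne i).some_mem⟩⟩
  rw [add_assoc (_ + _) (_ * _), ← ciInf_add_add_const_of_independent]
  · congr 1
    funext S
    have hS₀ (i) (hi : i ∈ Y₀) : S.1 i ∈ Z₀ := (hY₀ i).1 hi (S.2 i)
    have hS₁ (i) (hi : i ∈ Y₁) : S.1 i ∈ Z₁ := (hY₁ i).1 hi (S.2 i)
    have cross : ∑ i ∈ Y₀, ∑ j ∈ Y₁, (G.dist (S.1 i) (S.1 j) : ℝ) =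
        Y₁.card * ∑ i ∈ Y₀, (G.dist (S.1 i) t₀ : ℝ) +
          Y₀.card * ∑ j ∈ Y₁, (G.dist (S.1 j) t₁ : ℝ) +
          Y₀.card * Y₁.card * (G.dist t₀ t₁ : ℝ) := by
      have (i) (hi : i ∈ Y₀) (j) (hj : j ∈ Y₁) : (G.dist (S.1 i) (S.1 j) : ℝ) =
          G.dist (S.1 i) t₀ + G.dist (S.1 j) t₁ + G.dist t₀ t₁ := by
        rw [hdist t₀ _ _ (by simp) (hS₀ i hi) (hS₁ j hj),
          hdist t₁ _ _ (by simp) ht₀ (hS₁ j hj), G.dist_comm (u := t₁)]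
        push_cast
        ring
      rw [Finset.sum_congr rfl fun i hi => Finset.sum_congr rfl (this i hi)]
      simp only [Finset.sum_add_distrib, Finset.sum_const, nsmul_eq_mul, ← Finset.mul_sum]
      ring
    have cross' : ∑ i ∈ Y₁, ∑ j ∈ Y₀, (G.dist (S.1 i) (S.1 j) : ℝ) =
        ∑ i ∈ Y₀, ∑ j ∈ Y₁, (G.dist (S.1 i) (S.1 j) : ℝ) := by
      rw [Finset.sum_comm]
      simp only [G.dist_comm]
    have weight₀ : ∑ i ∈ Y₀, ∑ z ∈ Z₁, b z * (G.dist (S.1 i) z : ℝ) =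
        (∑ z ∈ Z₁, b z) * ∑ i ∈ Y₀, (G.dist (S.1 i) t₀ : ℝ) +
          Y₀.card * ∑ z ∈ Z₁, b z * (G.dist t₀ z : ℝ) := by
      have (i) (hi : i ∈ Y₀) (z) (hz : z ∈ Z₁) : b z * (G.dist (S.1 i) z : ℝ) =
          b z * G.dist (S.1 i) t₀ + b z * G.dist t₀ z := by
        rw [hdist t₀ _ _ (by simp) (hS₀ i hi) hz]
        push_cast
        ring
      rw [Finset.sum_congr rfl fun i hi => Finset.sum_congr rfl (this i hi)]
      simp only [Finset.sum_add_distrib, Finset.sum_const, nsmul_eq_mul, ← Finset.mul_sum,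
        ← Finset.sum_mul]
    have weight₁ : ∑ i ∈ Y₁, ∑ z ∈ Z₀, b z * (G.dist (S.1 i) z : ℝ) =
        (∑ z ∈ Z₀, b z) * ∑ i ∈ Y₁, (G.dist (S.1 i) t₁ : ℝ) +
          Y₁.card * ∑ z ∈ Z₀, b z * (G.dist t₁ z : ℝ) := by
      have (i) (hi : i ∈ Y₁) (z) (hz : z ∈ Z₀) : b z * (G.dist (S.1 i) z : ℝ) =
          b z * G.dist (S.1 i) t₁ + b z * G.dist t₁ z := by
        rw [G.dist_comm, hdist t₁ _ _ (by simp) hz (hS₁ i hi), G.dist_comm (u := z),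
          G.dist_comm (u := t₁) (v := S.1 i)]
        push_cast
        ring
      rw [Finset.sum_congr rfl fun i hi => Finset.sum_congr rfl (this i hi)]
      simp only [Finset.sum_add_distrib, Finset.sum_const, nsmul_eq_mul, ← Finset.mul_sum,
        ← Finset.sum_mul]
    simp only [sumY, sumZ, Finset.sum_add_distrib]
    rw [cross', cross, weight₀, weight₁]
    ring
  · intro S T
    have hT (i) (hi : i ∈ Y₁) : i ∉ Y₀ := Finset.disjoint_right.1 hYdisj hi
    refine ⟨⟨fun i => if i ∈ Y₀ then S.1 i else T.1 i, fun i => ?_⟩, ?_, ?_⟩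
    · dsimp only
      split_ifs
      exacts [S.2 i, T.2 i]
    · congr 1
      · congr 1
        · exact Finset.sum_congr rfl fun i hi => Finset.sum_congr rfl fun j hj => by
            simp only [if_pos hi, if_pos hj]
        · exact Finset.sum_congr rfl fun i hi => by simp only [if_pos hi]
      · exact congrArg _ (Finset.sum_congr rfl fun i hi => by simp only [if_pos hi])
    · congr 1
      · congr 1
        · exact Finset.sum_congr rfl fun i hi => Finset.sum_congr rfl fun j hj => by
            simp only [if_neg (hT i hi), if_neg (hT j hj)]
        · exact Finset.sum_congr rfl fun i hi => by simp only [if_neg (hT i hi)]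
      · exact congrArg _ (Finset.sum_congr rfl fun i hi => by simp only [if_neg (hT i hi)])
end

section
/- Let X_1,…,X_k be pairwise disjoint finite nonempty sets, let c assign a nonnegative capacity c(x,y) = c(y,x) to every pair x ∈ X_i, y ∈ X_j with i ≠ j, and let α = 2·max c over all such pairs (assume this maximum is positive). Let G be the simple graph on vertex set X_1 ∪ … ∪ X_k with an edge {x,y} of weight w({x,y}) = α − c(x,y) for every x ∈ X_i, y ∈ X_j, i ≠ j, and let d_w(u,v) denote the minimum, over all walks from u to v, of the sum of the edge weights along the walk. Then for every system of representatives S = {x_1,…,x_k} with x_i ∈ X_i, Σ_{i=1}^k Σ_{j=1}^k d_w(x_i,x_j) = k(k−1)·α − Σ_{i≠j} c(x_i,x_j); hence there exists a system of representatives of capacity greater than h if and only if there exists a system of representatives S with Σ_{i,j} d_w(x_i,x_j) less than k(k−1)·α − h. -/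
open Finset

namespace SimpleGraph

variable {V : Type*} {G : SimpleGraph V} {w : Sym2 V → ℝ} {b : ℝ} {u v : V}

theorem Walk.length_mul_le_sum_map_edges (hb : ∀ e ∈ G.edgeSet, b ≤ w e) (p : G.Walk u v) :
    p.length * b ≤ (p.edges.map w).sum := by
  have h := List.card_nsmul_le_sum (p.edges.map w) b fun r hr => by
    obtain ⟨e, he, rfl⟩ := List.mem_map.mp hr
    exact hb e (p.edges_subset_edgeSet he)
  simpa using h

/-- If every edge weighs at least half the weight of the edge `s(u, v)` between adjacent vertices, that
edge is a walk of minimum weight from `u` to `v`. -/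
theorem Adj.isLeast_walk_weight (h : G.Adj u v) (hb₀ : 0 ≤ b) (hb : ∀ e ∈ G.edgeSet, b ≤ w e)
    (huv : w s(u, v) ≤ 2 * b) :
    IsLeast {r : ℝ | ∃ p : G.Walk u v, (p.edges.map w).sum = r} (w s(u, v)) := by
  refine ⟨⟨h.toWalk, by simp⟩, ?_⟩
  rintro r ⟨p, rfl⟩
  match p with
  | .nil => exact absurd rfl h.ne
  | .cons _ .nil => simp
  | .cons h₁ (.cons h₂ q) =>
    have hlen := (Walk.cons h₁ (.cons h₂ q)).length_mul_le_sum_map_edges hb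
    have hq : 0 ≤ (q.length : ℝ) * b := by positivity
    simp only [Walk.length_cons, Nat.cast_add, Nat.cast_one] at hlen
    linarith

theorem isLeast_closed_walk_weight (hw : ∀ e ∈ G.edgeSet, 0 ≤ w e) (u : V) :
    IsLeast {r : ℝ | ∃ p : G.Walk u u, (p.edges.map w).sum = r} 0 := by
  refine ⟨⟨.nil, by simp⟩, ?_⟩
  rintro r ⟨p, rfl⟩
  simpa using p.length_mul_le_sum_map_edges hw

end SimpleGraph

/-- Summing a function that vanishes on the diagonal and is `a - f i j` off it. -/
theorem sum_sum_eq_card_mul_sub_sum_off_diagonal {ι : Type*} [Fintype ι] [DecidableEq ι]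
    {d f : ι → ι → ℝ} {a : ℝ} (hdiag : ∀ i, d i i = 0) (hoff : ∀ i j, i ≠ j → d i j = a - f i j) :
    ∑ i, ∑ j, d i j = (Fintype.card ι : ℝ) * ((Fintype.card ι : ℝ) - 1) * a -
      ∑ i, ∑ j ∈ univ.filter (fun j => j ≠ i), f i j := by
  have hrow (i : ι) : ∑ j, d i j =
      ((Fintype.card ι : ℝ) - 1) * a - ∑ j ∈ univ.filter (fun j => j ≠ i), f i j := by
    have hd (j : ι) : d i j = (a - if j = i then a else 0) - if j ≠ i then f i j else 0 := by
      by_cases h : j = i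
      · subst h; simp [hdiag]
      · simp [h, hoff i j (Ne.symm h)]
    simp_rw [hd, sum_sub_distrib, sum_filter]
    simp
    ring
  simp_rw [hrow, sum_sub_distrib]
  simp
  ring

/-- The reduction from MaxCRS to MinDIR: in the weighted graph with edge weights
`α − c(x,y)` between vertices of different parts, where `α` is twice the maximum
capacity, the all-pairs minimum-walk-weight cost of any system of representatives
`S` equals `k(k−1)α − Σ_{i≠j} c(x_i,x_j)`; hence there is a system of
representatives of capacity greater than `h` iff there is one whose distance cost
is less than `k(k−1)α − h`. -/
theorem maxCRS_to_minDIR_reduction {V : Type*} [Fintype V]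
    (k : ℕ) (hk : 2 ≤ k) (X : Fin k → Set V)
    (hXne : ∀ i, (X i).Nonempty)
    (hXdisj : ∀ i j, i ≠ j → Disjoint (X i) (X j))
    (hcover : ∀ v : V, ∃ i, v ∈ X i)
    (c : V → V → ℝ)
    (hcsymm : ∀ i j x y, i ≠ j → x ∈ X i → y ∈ X j → c x y = c y x)
    (hcnonneg : ∀ i j x y, i ≠ j → x ∈ X i → y ∈ X j → 0 ≤ c x y)
    (α : ℝ) (hα : 0 < α)
    (hαub : ∀ i j x y, i ≠ j → x ∈ X i → y ∈ X j → c x y ≤ α / 2)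
    (hαmax : ∃ i j x y, i ≠ j ∧ x ∈ X i ∧ y ∈ X j ∧ c x y = α / 2)
    (G : SimpleGraph V)
    (hG : ∀ u v, G.Adj u v ↔ ∃ i j, i ≠ j ∧ u ∈ X i ∧ v ∈ X j)
    (w : Sym2 V → ℝ)
    (hwdef : ∀ u v, G.Adj u v → w s(u, v) = α - c u v)
    (dw : V → V → ℝ)
    (hdw : ∀ u v, IsLeast {r : ℝ | ∃ p : G.Walk u v, (p.edges.map w).sum = r} (dw u v)) :
    (∀ S : Fin k → V, (∀ i, S i ∈ X i) →
      ∑ i : Fin k, ∑ j : Fin k, dw (S i) (S j) =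
        (k : ℝ) * ((k : ℝ) - 1) * α -
          ∑ i : Fin k, ∑ j ∈ Finset.univ.filter (fun j => j ≠ i), c (S i) (S j)) ∧
    (∀ h : ℝ,
      (∃ S : Fin k → V, (∀ i, S i ∈ X i) ∧
          h < ∑ i : Fin k, ∑ j ∈ Finset.univ.filter (fun j => j ≠ i), c (S i) (S j)) ↔
      (∃ S : Fin k → V, (∀ i, S i ∈ X i) ∧
          ∑ i : Fin k, ∑ j : Fin k, dw (S i) (S j) < (k : ℝ) * ((k : ℝ) - 1) * α - h)) := by
  have hedge : ∀ e ∈ G.edgeSet, α / 2 ≤ w e := by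
    intro e
    induction e with | _ u v
    intro huv
    obtain ⟨i, j, hij, hu, hv⟩ := (hG u v).mp huv
    rw [hwdef u v huv]
    linarith [hαub i j u v hij hu hv]
  have hcost : ∀ S : Fin k → V, (∀ i, S i ∈ X i) →
      ∑ i : Fin k, ∑ j : Fin k, dw (S i) (S j) =
        (k : ℝ) * ((k : ℝ) - 1) * α -
          ∑ i : Fin k, ∑ j ∈ Finset.univ.filter (fun j => j ≠ i), c (S i) (S j) := by
    intro S hS
    have hdiag (i : Fin k) : dw (S i) (S i) = 0 :=
      (hdw _ _).unique (SimpleGraph.isLeast_closed_walk_weight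
        (fun e he => by linarith [hedge e he]) _)
    have hoff (i j : Fin k) (hij : i ≠ j) : dw (S i) (S j) = α - c (S i) (S j) := by
      have hadj := (hG (S i) (S j)).mpr ⟨i, j, hij, hS i, hS j⟩
      rw [← hwdef _ _ hadj]
      refine (hdw _ _).unique (hadj.isLeast_walk_weight (half_pos hα).le hedge ?_)
      rw [hwdef _ _ hadj]
      linarith [hcnonneg i j _ _ hij (hS i) (hS j)]
    simpa using sum_sum_eq_card_mul_sub_sum_off_diagonal hdiag hoff
  refine ⟨hcost, fun h => exists_congr fun S => and_congr_right fun hS => ?_⟩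
  rw [hcost S hS]
  exact (sub_lt_sub_iff_left _).symm
end

section
/- Let G be a connected finite simple graph, let e = {x,y} be a bridge of G, and let x_1,…,x_k and x'_1,…,x'_k be vertices with {i : x_i ∈ Z_x} = {i : x'_i ∈ Z_x} = A and such that x_i = x'_i for all i ∈ A (i.e., the two selections agree on the Z_x-side). Then the difference Σ_{i,j} d(x_i,x_j) − Σ_{i,j} d(x'_i,x'_j) depends only on the vertices selected on the Z_y-side; explicitly, it equals Σ_{i,j ∈ B} d(x_i,x_j) − Σ_{i,j ∈ B} d(x'_i,x'_j) + 2|A|·( Σ_{j ∈ B} d(y,x_j) − Σ_{j ∈ B} d(y,x'_j) ), where B is the complement of A. In particular, the all-pairs distance cost can be minimized separately on the two sides of a bridge. -/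
open Finset

namespace SimpleGraph

variable {V : Type*} {G : SimpleGraph V} {x y u v : V}

/-- A walk leaving the component of `x` in `G - xy` passes through `y`. -/
lemma Walk.mem_support_of_reachable_deleteEdges (p : G.Walk u v)
    (hu : (G.deleteEdges {s(x, y)}).Reachable x u)
    (hv : ¬ (G.deleteEdges {s(x, y)}).Reachable x v) : y ∈ p.support := by
  induction p with
  | nil => exact absurd hu hv
  | @cons a b c hab q ih =>
    by_cases hb : (G.deleteEdges {s(x, y)}).Reachable x b
    · simp [ih hb hv]
    · have he : s(a, b) = s(x, y) := by
        by_contra he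
        exact hb (hu.trans (Adj.reachable (by simp [deleteEdges_adj, hab, he])))
      rcases Sym2.eq_iff.mp he with ⟨-, rfl⟩ | ⟨-, rfl⟩
      · simp
      · exact absurd (Reachable.refl _) hb

/-- A vertex lying on every walk from `u` to `v` splits the distance between them. -/
lemma Connected.dist_eq_add_of_forall_mem_support (hG : G.Connected)
    (h : ∀ p : G.Walk u v, y ∈ p.support) : G.dist u v = G.dist u y + G.dist y v := by
  classical
  refine le_antisymm hG.dist_triangle ?_
  obtain ⟨p, hp⟩ := hG.exists_walk_length_eq_dist u v
  have hlen := congrArg Walk.length (p.take_spec (h p))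
  rw [Walk.length_append] at hlen
  have h₁ := dist_le (p.takeUntil y (h p))
  have h₂ := dist_le (p.dropUntil y (h p))
  omega

end SimpleGraph

/-- The sum of a symmetric kernel that splits as `a i + b j` for `i ∈ A`, `j ∉ A`. -/
lemma Finset.sum_sum_eq_of_symm_of_split {ι : Type*} [Fintype ι] [DecidableEq ι]
    (A : Finset ι) (d : ι → ι → ℤ) (a b : ι → ℤ) (hsymm : ∀ i j, d i j = d j i)
    (hsplit : ∀ i ∈ A, ∀ j ∈ Aᶜ, d i j = a i + b j) :
    ∑ i, ∑ j, d i j = ∑ i ∈ A, ∑ j ∈ A, d i j + ∑ i ∈ Aᶜ, ∑ j ∈ Aᶜ, d i j +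
      2 * ((Aᶜ.card : ℤ) * ∑ i ∈ A, a i + (A.card : ℤ) * ∑ j ∈ Aᶜ, b j) := by
  have hcross : ∑ i ∈ A, ∑ j ∈ Aᶜ, d i j =
      (Aᶜ.card : ℤ) * ∑ i ∈ A, a i + (A.card : ℤ) * ∑ j ∈ Aᶜ, b j := by
    rw [Finset.sum_congr rfl fun i hi => Finset.sum_congr rfl (hsplit i hi)]
    simp only [Finset.sum_add_distrib, Finset.sum_const, nsmul_eq_mul, Finset.mul_sum]
  have hcross' : ∑ i ∈ Aᶜ, ∑ j ∈ A, d i j = ∑ i ∈ A, ∑ j ∈ Aᶜ, d i j := by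
    rw [Finset.sum_comm]
    simp only [hsymm]
  simp only [← Finset.sum_add_sum_compl A, Finset.sum_add_distrib]
  linarith

/-- If two selections agree on the `Z_x`-side of a bridge `e = {x,y}`, then the
difference of their all-pairs distance costs depends only on the vertices
selected on the `Z_y`-side. -/
theorem allPairs_dist_cost_diff_across_bridge {V : Type*} [Fintype V]
    (G : SimpleGraph V) (hG : G.Connected) (x y : V) (hxy : G.Adj x y)
    (hbridge : ¬ (G.deleteEdges {s(x, y)}).Reachable x y)
    (k : ℕ) (f f' : Fin k → V) (A : Finset (Fin k))
    (hA : ∀ i, i ∈ A ↔ (G.deleteEdges {s(x, y)}).Reachable x (f i))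
    (hA' : ∀ i, i ∈ A ↔ (G.deleteEdges {s(x, y)}).Reachable x (f' i))
    (hagree : ∀ i ∈ A, f i = f' i) :
    (∑ i : Fin k, ∑ j : Fin k, (G.dist (f i) (f j) : ℤ)) -
      (∑ i : Fin k, ∑ j : Fin k, (G.dist (f' i) (f' j) : ℤ)) =
    ((∑ i ∈ Aᶜ, ∑ j ∈ Aᶜ, (G.dist (f i) (f j) : ℤ)) -
        (∑ i ∈ Aᶜ, ∑ j ∈ Aᶜ, (G.dist (f' i) (f' j) : ℤ))) +
    2 * (A.card : ℤ) *
      ((∑ j ∈ Aᶜ, (G.dist y (f j) : ℤ)) - (∑ j ∈ Aᶜ, (G.dist y (f' j) : ℤ))) := by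
  have hsplit (g : Fin k → V)
      (hg : ∀ i, i ∈ A ↔ (G.deleteEdges {s(x, y)}).Reachable x (g i)) :
      ∀ i ∈ A, ∀ j ∈ Aᶜ, (G.dist (g i) (g j) : ℤ) = G.dist (g i) y + G.dist y (g j) := by
    intro i hi j hj
    exact_mod_cast hG.dist_eq_add_of_forall_mem_support fun p =>
      p.mem_support_of_reachable_deleteEdges ((hg i).mp hi)
        (mt (hg j).mpr (Finset.mem_compl.mp hj))
  have hsymm (g : Fin k → V) (i j : Fin k) :
      (G.dist (g i) (g j) : ℤ) = G.dist (g j) (g i) := by rw [SimpleGraph.dist_comm]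
  have hinner : ∑ i ∈ A, ∑ j ∈ A, (G.dist (f i) (f j) : ℤ) =
      ∑ i ∈ A, ∑ j ∈ A, (G.dist (f' i) (f' j) : ℤ) :=
    Finset.sum_congr rfl fun i hi => Finset.sum_congr rfl fun j hj => by
      rw [hagree i hi, hagree j hj]
  have hport : ∑ i ∈ A, (G.dist (f i) y : ℤ) = ∑ i ∈ A, (G.dist (f' i) y : ℤ) :=
    Finset.sum_congr rfl fun i hi => by rw [hagree i hi]
  rw [Finset.sum_sum_eq_of_symm_of_split A _ _ _ (hsymm f) (hsplit f hA),
    Finset.sum_sum_eq_of_symm_of_split A _ _ _ (hsymm f') (hsplit f' hA'), hinner, hport]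
  ring
end
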